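/- Let g ∈ C_c^∞(ℝ^d) and suppose u ∈ C³(ℝ^d) satisfies u(x) − Δu(x) + ⟨∇U(x), ∇u(x)⟩ = g(x) for all x ∈ ℝ^d, ∫ u² dπ ≤ ∫ g² dπ, ∫ |∇u|² dπ ≤ ∫ g² dπ, and ∫ ‖∇²u‖_F² dπ ≤ 2(2 + c_U) ∫ g² dπ. Then ∫ ⟨∇U(x), ∇u(x)⟩² dπ(x) ≤ ( 32(2 + c_U) + 4 C_U d^{1+ω} ) ∫ g(x)² dπ(x). -/

import Mathlib

open MeasureTheory Real
open scoped RealInnerProductSpace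

/-- The Laplacian of `U`, defined as the sum of second partial derivatives. -/
noncomputable def lapl (d : ℕ) (U : EuclideanSpace ℝ (Fin d) → ℝ)
    (x : EuclideanSpace ℝ (Fin d)) : ℝ :=
  ∑ i : Fin d,
    fderiv ℝ (fun y => fderiv ℝ U y (EuclideanSpace.single i 1)) x (EuclideanSpace.single i 1)

/-- The Gibbs probability measure `π` with density `Z⁻¹ e^{-U}` w.r.t. Lebesgue measure. -/
noncomputable def gibbs (d : ℕ) (U : EuclideanSpace ℝ (Fin d) → ℝ) (Z : ℝ) :
    Measure (EuclideanSpace ℝ (Fin d)) :=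
  volume.withDensity (fun x => ENNReal.ofReal (Real.exp (-U x) / Z))

/-- Squared Frobenius norm of the Hessian of `u`. -/
noncomputable def hessFS (d : ℕ) (u : EuclideanSpace ℝ (Fin d) → ℝ)
    (x : EuclideanSpace ℝ (Fin d)) : ℝ :=
  ∑ i : Fin d, ∑ j : Fin d,
    (fderiv ℝ (fun y => fderiv ℝ u y (EuclideanSpace.single j 1)) x
      (EuclideanSpace.single i 1)) ^ 2

/-- Divergence of a vector field `F`. -/
noncomputable def diverg (d : ℕ)
    (F : EuclideanSpace ℝ (Fin d) → EuclideanSpace ℝ (Fin d))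
    (x : EuclideanSpace ℝ (Fin d)) : ℝ :=
  ∑ i : Fin d, fderiv ℝ (fun y => F y i) x (EuclideanSpace.single i 1)

open Filter Topology

/-- partial derivative -/
noncomputable def pd {d : ℕ} (f : EuclideanSpace ℝ (Fin d) → ℝ) (i : Fin d)
    (x : EuclideanSpace ℝ (Fin d)) : ℝ := fderiv ℝ f x (EuclideanSpace.single i 1)

lemma pd_contDiff {d : ℕ} {f : EuclideanSpace ℝ (Fin d) → ℝ} {n m : ℕ}
    (hf : ContDiff ℝ n f) (h : m + 1 ≤ n) (i : Fin d) : ContDiff ℝ m (pd f i) := by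
  unfold pd
  have h1 : ContDiff ℝ m (fderiv ℝ f) := hf.fderiv_right (by exact_mod_cast h)
  exact h1.clm_apply contDiff_const

lemma integral_pd_zero {d : ℕ} {f : EuclideanSpace ℝ (Fin d) → ℝ} (hf : ContDiff ℝ 1 f)
    (hc : HasCompactSupport f) (i : Fin d) : ∫ x, pd f i x = 0 := by
  have hcont : Continuous (pd f i) := by
    have := pd_contDiff (n := 1) (m := 0) (by exact_mod_cast hf) le_rfl i
    exact this.continuous
  have hi : Integrable (fun x => pd f i x) :=
    hcont.integrable_of_hasCompactSupport (hc.fderiv_apply (𝕜 := ℝ) _)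
  have := integral_smul_fderiv_eq_neg_fderiv_smul_of_integrable (𝕜 := ℝ)
    (μ := (volume : Measure (EuclideanSpace ℝ (Fin d))))
    (f := fun _ => (1 : ℝ)) (g := f) (v := EuclideanSpace.single i 1)
    (by simp) (by simpa [pd] using hi)
    (by simpa using hf.continuous.integrable_of_hasCompactSupport hc)
    (fun x _ => by fun_prop) (fun x _ => (hf.differentiable (by norm_num)).differentiableAt)
  simpa [pd] using this

lemma grad_apply {d : ℕ} (f : EuclideanSpace ℝ (Fin d) → ℝ) (x : EuclideanSpace ℝ (Fin d))
    (i : Fin d) : gradient f x i = pd f i x := by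
  have h : fderiv ℝ f x = InnerProductSpace.toDual ℝ _ (gradient f x) := by
    simp [gradient]
  rw [pd, h, InnerProductSpace.toDual_apply_apply, EuclideanSpace.inner_single_right]
  simp

lemma grad_norm {d : ℕ} (f : EuclideanSpace ℝ (Fin d) → ℝ) (x : EuclideanSpace ℝ (Fin d)) :
    ‖gradient f x‖ ^ 2 = ∑ i, (pd f i x) ^ 2 := by
  rw [EuclideanSpace.norm_sq_eq]
  simp [grad_apply]

lemma pd_div {d : ℕ} {U h : EuclideanSpace ℝ (Fin d) → ℝ} (hU : ContDiff ℝ 2 U)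
    (hh : ContDiff ℝ 1 h) (Z : ℝ) (i : Fin d) (x : EuclideanSpace ℝ (Fin d)) :
    pd (fun y => Real.exp (-U y) / Z * (h y ^ 2 * pd U i y)) i x =
      Real.exp (-U x) / Z * (-(pd U i x) ^ 2 * h x ^ 2 + 2 * h x * pd h i x * pd U i x
        + h x ^ 2 * pd (pd U i) i x) := by
  have hUx : HasFDerivAt U (fderiv ℝ U x) x :=
    (hU.differentiable (by norm_num)).differentiableAt.hasFDerivAt
  have hhx : HasFDerivAt h (fderiv ℝ h x) x :=
    (hh.differentiable (by norm_num)).differentiableAt.hasFDerivAt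
  have hp : ContDiff ℝ 1 (pd U i) := by
    have := pd_contDiff (n := 2) (m := 1) (by exact_mod_cast hU) le_rfl i
    exact_mod_cast this
  have hpx : HasFDerivAt (pd U i) (fderiv ℝ (pd U i) x) x :=
    (hp.differentiable (by norm_num)).differentiableAt.hasFDerivAt
  have ha := (hUx.neg.exp).mul_const (Z⁻¹)
  have hhq : HasFDerivAt (fun y => h y ^ 2) _ x := hhx.pow 2
  have hb := hhq.mul hpx
  have h1 := ha.mul hb
  have h2 := h1.congr_of_eventuallyEq
    (f₁ := fun y => Real.exp (-U y) / Z * (h y ^ 2 * pd U i y))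
    (Eventually.of_forall fun y => by simp [div_eq_mul_inv])
  rw [pd, h2.fderiv]
  simp [pd]
  ring

lemma compact_ineq {d : ℕ} {U h : EuclideanSpace ℝ (Fin d) → ℝ} (hU : ContDiff ℝ 2 U)
    (hh : ContDiff ℝ 1 h) (hc : HasCompactSupport h) {Z : ℝ} (hZ : 0 < Z) {K : ℝ} (hK : 0 ≤ K)
    (hLap : ∀ x, lapl d U x ≤ K + ‖gradient U x‖ ^ 2 / 2) :
    ∫⁻ x, ENNReal.ofReal ((∑ i, (pd U i x) ^ 2) * h x ^ 2 * (Real.exp (-U x) / Z)) ≤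
    ∫⁻ x, ENNReal.ofReal
      ((4 * K * h x ^ 2 + 16 * ∑ i, (pd h i x) ^ 2) * (Real.exp (-U x) / Z)) := by
  have hp : ∀ i, ContDiff ℝ 1 (pd U i) := fun i => by
    have := pd_contDiff (n := 2) (m := 1) (by exact_mod_cast hU) le_rfl i
    exact_mod_cast this
  have hpc : ∀ i, Continuous (pd U i) := fun i => (hp i).continuous
  have hhc : ∀ i, Continuous (pd h i) := fun i => by
    have := pd_contDiff (n := 1) (m := 0) (by exact_mod_cast hh) le_rfl i
    exact this.continuous
  have hUc := hU.continuous
  have hhc0 := hh.continuous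
  have hh2 : HasCompactSupport (fun x => h x ^ 2) := hc.comp_left (g := fun t => t ^ 2) (by simp)
  have hFc : ∀ i, HasCompactSupport
      (fun y => Real.exp (-U y) / Z * (h y ^ 2 * pd U i y)) := fun i =>
    (hh2.mul_right).mul_left
  have hF : ∀ i, ContDiff ℝ 1 (fun y => Real.exp (-U y) / Z * (h y ^ 2 * pd U i y)) := fun i => by
    have hU1 : ContDiff ℝ 1 U := hU.of_le (by norm_num)
    have := hp i
    fun_prop
  have hFi : ∀ i, Integrable (pd (fun y => Real.exp (-U y) / Z * (h y ^ 2 * pd U i y)) i) :=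
    fun i => by
      refine Continuous.integrable_of_hasCompactSupport ?_ ((hFc i).fderiv_apply (𝕜 := ℝ) _)
      have := pd_contDiff (n := 1) (m := 0) (by exact_mod_cast hF i) le_rfl i
      exact this.continuous
  have hPi : ∫ x, ∑ i, pd (fun y => Real.exp (-U y) / Z * (h y ^ 2 * pd U i y)) i x = 0 := by
    rw [integral_finsetSum _ (fun i _ => hFi i)]
    exact Finset.sum_eq_zero fun i _ => integral_pd_zero (hF i) (hFc i) i
  have hPint : Integrable
      (fun x => ∑ i, pd (fun y => Real.exp (-U y) / Z * (h y ^ 2 * pd U i y)) i x) :=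
    integrable_finsetSum _ (fun i _ => hFi i)
  have hLi : Integrable
      (fun x => (∑ i, (pd U i x) ^ 2) * h x ^ 2 * (Real.exp (-U x) / Z)) := by
    refine Continuous.integrable_of_hasCompactSupport (by fun_prop) ?_
    exact (hh2.mul_left).mul_right
  have hRi : Integrable (fun x =>
      (4 * K * h x ^ 2 + 16 * ∑ i, (pd h i x) ^ 2) * (Real.exp (-U x) / Z)) := by
    refine Continuous.integrable_of_hasCompactSupport (by fun_prop) ?_
    refine HasCompactSupport.mul_right ?_
    refine HasCompactSupport.add (hh2.mul_left) (HasCompactSupport.mul_left ?_)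
    have h1 := hc.fderiv (𝕜 := ℝ)
    exact h1.comp_left (g := fun L : EuclideanSpace ℝ (Fin d) →L[ℝ] ℝ =>
      ∑ i, (L (EuclideanSpace.single i 1)) ^ 2) (by simp)
  have hρ : ∀ x, 0 ≤ Real.exp (-U x) / Z := fun x => by positivity
  rw [← ofReal_integral_eq_lintegral_ofReal hLi (ae_of_all _ fun x => by positivity),
    ← ofReal_integral_eq_lintegral_ofReal hRi (ae_of_all _ fun x => by positivity)]
  apply ENNReal.ofReal_le_ofReal
  have key : ∫ x, (∑ i, (pd U i x) ^ 2) * h x ^ 2 * (Real.exp (-U x) / Z) ≤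
      ∫ x, ((4 * K * h x ^ 2 + 16 * ∑ i, (pd h i x) ^ 2) * (Real.exp (-U x) / Z) - 4 *
        ∑ i, pd (fun y => Real.exp (-U y) / Z * (h y ^ 2 * pd U i y)) i x) := by
    refine integral_mono hLi (hRi.sub (hPint.const_mul 4)) fun x => ?_
    dsimp only
    simp_rw [pd_div hU hh]
    rw [← Finset.mul_sum]
    have hL := hLap x
    rw [grad_norm] at hL
    have hlap : lapl d U x = ∑ i, pd (pd U i) i x := rfl
    rw [hlap] at hL
    have hsq : 0 ≤ ∑ i, (4 * pd h i x - h x * pd U i x) ^ 2 :=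
      Finset.sum_nonneg fun i _ => sq_nonneg _
    have e1 : ∑ i, (4 * pd h i x - h x * pd U i x) ^ 2 = 16 * ∑ i, (pd h i x) ^ 2
        - 8 * h x * ∑ i, pd h i x * pd U i x + h x ^ 2 * ∑ i, (pd U i x) ^ 2 := by
      simp only [Finset.mul_sum, ← Finset.sum_sub_distrib, ← Finset.sum_add_distrib]
      exact Finset.sum_congr rfl fun i _ => by ring
    have e2 : ∑ i, (-(pd U i x) ^ 2 * h x ^ 2 + 2 * h x * pd h i x * pd U i x
        + h x ^ 2 * pd (pd U i) i x) = -(∑ i, (pd U i x) ^ 2) * h x ^ 2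
          + 2 * h x * ∑ i, pd h i x * pd U i x + h x ^ 2 * ∑ i, pd (pd U i) i x := by
      simp only [Finset.mul_sum, Finset.sum_mul, ← Finset.sum_neg_distrib,
        ← Finset.sum_add_distrib]
      exact Finset.sum_congr rfl fun i _ => by ring
    rw [e2]
    rw [e1] at hsq
    have hq := mul_le_mul_of_nonneg_left hL (sq_nonneg (h x))
    have := hρ x
    have hfin : (∑ i, (pd U i x) ^ 2) * h x ^ 2 ≤ (4 * K * h x ^ 2 + 16 * ∑ i, (pd h i x) ^ 2)
       - 4 * (-(∑ i, (pd U i x) ^ 2) * h x ^ 2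
          + 2 * h x * ∑ i, pd h i x * pd U i x + h x ^ 2 * ∑ i, pd (pd U i) i x) := by
      nlinarith
    have := mul_le_mul_of_nonneg_right hfin this
    linarith
  rw [integral_sub hRi (hPint.const_mul 4), integral_const_mul, hPi] at key
  linarith

lemma cutoff (d : ℕ) : ∃ M : ℝ, 0 ≤ M ∧ ∀ ε : ℝ, 0 < ε →
    ∃ χ : EuclideanSpace ℝ (Fin d) → ℝ, ContDiff ℝ 1 χ ∧ HasCompactSupport χ ∧
      (∀ x, 0 ≤ χ x ∧ χ x ≤ 1) ∧ (∀ x, ε * ‖x‖ ≤ 1 → χ x = 1) ∧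
      ∀ x, ∑ i, (pd χ i x) ^ 2 ≤ M * ε ^ 2 := by
  let b : ContDiffBump (0 : EuclideanSpace ℝ (Fin d)) := ⟨1, 2, by norm_num, by norm_num⟩
  have hb : ContDiff ℝ 1 b := b.contDiff
  have hbc : Continuous (fun x => ∑ i, (pd b i x) ^ 2) := by
    have : ∀ i, Continuous (pd b i) := fun i => by
      have := pd_contDiff (n := 1) (m := 0) (by exact_mod_cast hb) le_rfl i
      exact this.continuous
    fun_prop
  have hbs : HasCompactSupport (fun x => ∑ i, (pd b i x) ^ 2) :=
    (b.hasCompactSupport.fderiv (𝕜 := ℝ)).comp_left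
      (g := fun L : EuclideanSpace ℝ (Fin d) →L[ℝ] ℝ =>
      ∑ i, (L (EuclideanSpace.single i 1)) ^ 2) (by simp)
  obtain ⟨M, hM⟩ := hbs.exists_bound_of_continuous hbc
  refine ⟨M, (norm_nonneg _).trans (hM 0), fun ε hε => ⟨fun x => b (ε • x), ?_, ?_, ?_, ?_, ?_⟩⟩
  · exact hb.comp (contDiff_const_smul ε)
  · exact b.hasCompactSupport.comp_smul hε.ne'
  · exact fun x => ⟨b.nonneg, b.le_one⟩
  · intro x hx
    apply b.one_of_mem_closedBall
    simpa [norm_smul, abs_of_pos hε, b] using hx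
  · intro x
    have : ∀ i, pd (fun x => b (ε • x)) i x = ε * pd b i (ε • x) := fun i => by
      simp [pd, fderiv_comp_smul]
    simp_rw [this, mul_pow]
    rw [← Finset.mul_sum, mul_comm]
    have := (le_abs_self _).trans (hM (ε • x))
    gcongr

lemma full_ineq {d : ℕ} {U f : EuclideanSpace ℝ (Fin d) → ℝ} (hU : ContDiff ℝ 2 U)
    (hf : ContDiff ℝ 1 f) {Z : ℝ} (hZ : 0 < Z) {K : ℝ} (hK : 0 ≤ K)
    (hLap : ∀ x, lapl d U x ≤ K + ‖gradient U x‖ ^ 2 / 2)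
    (hA : ∫⁻ x, ENNReal.ofReal (f x ^ 2 * (Real.exp (-U x) / Z)) ≠ ⊤) :
    ∫⁻ x, ENNReal.ofReal ((∑ i, (pd U i x) ^ 2) * f x ^ 2 * (Real.exp (-U x) / Z)) ≤
    ENNReal.ofReal (4 * K) * (∫⁻ x, ENNReal.ofReal (f x ^ 2 * (Real.exp (-U x) / Z))) +
    ENNReal.ofReal 16 *
      ∫⁻ x, ENNReal.ofReal ((∑ i, (pd f i x) ^ 2) * (Real.exp (-U x) / Z)) := by
  obtain ⟨M, hM0, hM⟩ := cutoff d
  let ε : ℕ → ℝ := fun n => 1 / ((n : ℝ) + 1)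
  have hε : ∀ n, 0 < ε n := fun n => by positivity
  have hεt : Tendsto ε atTop (𝓝 0) := tendsto_one_div_add_atTop_nhds_zero_nat
  choose χ hχ1 hχc hχb hχe hχd using fun n => hM (ε n) (hε n)
  have hρ : ∀ x, 0 ≤ Real.exp (-U x) / Z := fun x => by positivity
  have hpc : ∀ i, Continuous (pd U i) := fun i => by
    have := pd_contDiff (n := 2) (m := 1) (by exact_mod_cast hU) le_rfl i
    exact this.continuous
  have hfc : ∀ i, Continuous (pd f i) := fun i => by
    have := pd_contDiff (n := 1) (m := 0) (by exact_mod_cast hf) le_rfl i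
    exact this.continuous
  have hUc := hU.continuous
  have hfc0 := hf.continuous
  have hχc0 := fun n => (hχ1 n).continuous
  set A := ∫⁻ x, ENNReal.ofReal (f x ^ 2 * (Real.exp (-U x) / Z)) with hAdef
  set B := ∫⁻ x, ENNReal.ofReal ((∑ i, (pd f i x) ^ 2) * (Real.exp (-U x) / Z)) with hBdef
  have hn : ∀ n, ∫⁻ x, ENNReal.ofReal
      ((∑ i, (pd U i x) ^ 2) * (χ n x * f x) ^ 2 * (Real.exp (-U x) / Z)) ≤
      ENNReal.ofReal (4 * K + 16 * M * (ε n + ε n ^ 2)) * A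
        + ENNReal.ofReal (16 * (1 + ε n)) * B := by
    intro n
    have he := hε n
    have h1 := compact_ineq (h := fun x => χ n x * f x) hU ((hχ1 n).mul hf)
      ((hχc n).mul_right) hZ hK hLap
    refine h1.trans ?_
    have hm1 : Measurable (fun x => ENNReal.ofReal (f x ^ 2 * (Real.exp (-U x) / Z))) :=
      (Continuous.measurable (by fun_prop)).ennreal_ofReal
    have hm2 : Measurable (fun x => ENNReal.ofReal
        ((∑ i, (pd f i x) ^ 2) * (Real.exp (-U x) / Z))) :=
      (Continuous.measurable (by fun_prop)).ennreal_ofReal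
    rw [hAdef, hBdef, ← lintegral_const_mul _ hm1, ← lintegral_const_mul _ hm2,
      ← lintegral_add_left (hm1.const_mul _)]
    refine lintegral_mono fun x => ?_
    dsimp only
    rw [← ENNReal.ofReal_mul (by positivity), ← ENNReal.ofReal_mul (by positivity),
      ← ENNReal.ofReal_add (by have := hρ x; positivity) (by have := hρ x; positivity)]
    apply ENNReal.ofReal_le_ofReal
    rw [← mul_assoc, ← mul_assoc, ← add_mul]
    refine mul_le_mul_of_nonneg_right ?_ (hρ x)
    have hprod : ∀ i, pd (fun x => χ n x * f x) i x = χ n x * pd f i x + f x * pd (χ n) i x :=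
      fun i => by
        have := fderiv_mul ((hχ1 n).differentiable (by norm_num) x)
          (hf.differentiable (by norm_num) x)
        rw [pd, show (fun x => χ n x * f x) = χ n * f from rfl, this]
        simp [pd]
    simp_rw [hprod]
    have hc2 : χ n x ^ 2 ≤ 1 := by
      have := hχb n x
      nlinarith [this.1, this.2]
    have hi : ∀ i, (χ n x * pd f i x + f x * pd (χ n) i x) ^ 2 ≤
        (1 + ε n) * pd f i x ^ 2 + (1 + 1 / ε n) * f x ^ 2 * pd (χ n) i x ^ 2 := by
      intro i
      have y : (χ n x * pd f i x) ^ 2 ≤ pd f i x ^ 2 := by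
        rw [mul_pow]; nlinarith [sq_nonneg (pd f i x)]
      generalize χ n x * pd f i x = a at *
      have hb : f x ^ 2 * pd (χ n) i x ^ 2 = (f x * pd (χ n) i x) ^ 2 := by ring
      rw [mul_assoc, hb]
      generalize f x * pd (χ n) i x = b at *
      have s : 0 ≤ (ε n * a - b) ^ 2 / ε n := by positivity
      have s2 : (ε n * a - b) ^ 2 / ε n = ε n * a ^ 2 - 2 * a * b + 1 / ε n * b ^ 2 := by
        field_simp
        ring
      nlinarith
    have hs := Finset.sum_le_sum fun i (_ : i ∈ Finset.univ) => hi i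
    rw [Finset.sum_add_distrib, ← Finset.mul_sum, ← Finset.mul_sum] at hs
    have hd := mul_le_mul_of_nonneg_left (hχd n x)
      (show 0 ≤ (1 + 1 / ε n) * f x ^ 2 by positivity)
    have hd2 : (1 + 1 / ε n) * f x ^ 2 * (M * ε n ^ 2) = M * (ε n + ε n ^ 2) * f x ^ 2 := by
      field_simp
      ring
    have hk : 4 * K * (χ n x * f x) ^ 2 ≤ 4 * K * f x ^ 2 := by
      rw [mul_pow]
      have : χ n x ^ 2 * f x ^ 2 ≤ f x ^ 2 := by nlinarith [sq_nonneg (f x)]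
      gcongr
    linarith
  have hlim : Tendsto (fun n => ENNReal.ofReal (4 * K + 16 * M * (ε n + ε n ^ 2)) * A
        + ENNReal.ofReal (16 * (1 + ε n)) * B) atTop
      (𝓝 (ENNReal.ofReal (4 * K) * A + ENNReal.ofReal 16 * B)) := by
    refine Tendsto.add (ENNReal.Tendsto.mul_const ?_ (Or.inr hA))
      (ENNReal.Tendsto.mul_const ?_ (Or.inl (by simp)))
    · apply ENNReal.tendsto_ofReal
      have := ((hεt.add (hεt.pow 2)).const_mul (16 * M)).const_add (4 * K)
      simpa using this
    · apply ENNReal.tendsto_ofReal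
      have := (hεt.const_add 1).const_mul 16
      simpa using this
  rw [← hlim.liminf_eq]
  have hpt : ∀ x, liminf (fun n => ENNReal.ofReal
      ((∑ i, (pd U i x) ^ 2) * (χ n x * f x) ^ 2 * (Real.exp (-U x) / Z))) atTop =
      ENNReal.ofReal ((∑ i, (pd U i x) ^ 2) * f x ^ 2 * (Real.exp (-U x) / Z)) := by
    intro x
    apply Tendsto.liminf_eq
    apply tendsto_const_nhds.congr'
    have : Tendsto (fun n => ε n * ‖x‖) atTop (𝓝 0) := by simpa using hεt.mul_const ‖x‖
    filter_upwards [this.eventually (gt_mem_nhds zero_lt_one)] with n hn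
    rw [hχe n x hn.le, one_mul]
  simp_rw [← hpt]
  refine (lintegral_liminf_le fun n => ?_).trans (liminf_le_liminf (Eventually.of_forall hn))
  have := hχc0 n
  exact (Continuous.measurable (by fun_prop)).ennreal_ofReal

lemma gibbs_lintegral {d : ℕ} {U h : EuclideanSpace ℝ (Fin d) → ℝ} (hU : Continuous U)
    (hh : Continuous h) (h0 : ∀ x, 0 ≤ h x) (Z : ℝ) :
    ∫⁻ x, ENNReal.ofReal (h x) ∂(gibbs d U Z) =
      ∫⁻ x, ENNReal.ofReal (h x * (Real.exp (-U x) / Z)) := by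
  rw [gibbs, lintegral_withDensity_eq_lintegral_mul]
  · refine lintegral_congr fun x => ?_
    rw [Pi.mul_apply, mul_comm, ENNReal.ofReal_mul (h0 x)]
  · exact (Continuous.measurable (by fun_prop)).ennreal_ofReal
  · exact hh.measurable.ennreal_ofReal

/-- Bound on `∫ ⟨∇U, ∇u⟩² dπ` for the solution of the Poisson equation:
`∫ ⟨∇U, ∇u⟩² dπ ≤ (32(2 + c_U) + 4 C_U d^{1+ω}) ∫ g² dπ`. -/
theorem stmt8 (d : ℕ) (hd : 1 ≤ d) (U : EuclideanSpace ℝ (Fin d) → ℝ)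
    (hU : ContDiff ℝ 2 U)
    (hIntU : Integrable (fun x => Real.exp (-U x)))
    (Z : ℝ) (hZ : Z = ∫ x, Real.exp (-U x))
    (c_U : ℝ) (hcU : 0 ≤ c_U)
    (hHessU : ∀ x v : EuclideanSpace ℝ (Fin d),
      -c_U * ‖v‖ ^ 2 ≤ fderiv ℝ (fun y => fderiv ℝ U y v) x v)
    (C_U ω : ℝ) (hCU : 0 < C_U) (hω : 0 ≤ ω)
    (hLap : ∀ x, lapl d U x ≤ C_U * (d : ℝ) ^ ((1 : ℝ) + ω) + ‖gradient U x‖ ^ 2 / 2)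
    (g : EuclideanSpace ℝ (Fin d) → ℝ)
    (hg : ContDiff ℝ (⊤ : ℕ∞) g) (hgc : HasCompactSupport g)
    (u : EuclideanSpace ℝ (Fin d) → ℝ) (hu : ContDiff ℝ 3 u)
    (hPoisson : ∀ x, u x - lapl d u x + ⟪gradient U x, gradient u x⟫ = g x)
    (hu2 : ∫⁻ x, ENNReal.ofReal ((u x) ^ 2) ∂(gibbs d U Z)
      ≤ ∫⁻ x, ENNReal.ofReal ((g x) ^ 2) ∂(gibbs d U Z))
    (hgradu2 : ∫⁻ x, ENNReal.ofReal (‖gradient u x‖ ^ 2) ∂(gibbs d U Z)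
      ≤ ∫⁻ x, ENNReal.ofReal ((g x) ^ 2) ∂(gibbs d U Z))
    (hhessu2 : ∫⁻ x, ENNReal.ofReal (hessFS d u x) ∂(gibbs d U Z)
      ≤ ENNReal.ofReal (2 * (2 + c_U))
          * ∫⁻ x, ENNReal.ofReal ((g x) ^ 2) ∂(gibbs d U Z)) :
    ∫⁻ x, ENNReal.ofReal (⟪gradient U x, gradient u x⟫ ^ 2) ∂(gibbs d U Z)
      ≤ ENNReal.ofReal (32 * (2 + c_U) + 4 * C_U * (d : ℝ) ^ ((1 : ℝ) + ω))
          * ∫⁻ x, ENNReal.ofReal ((g x) ^ 2) ∂(gibbs d U Z) := by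
  have hUc := hU.continuous
  have hZp : 0 < Z := by
    rw [hZ]
    exact integral_exp_pos hIntU
  have hK : 0 ≤ C_U * (d : ℝ) ^ ((1 : ℝ) + ω) := by positivity
  rw [mul_assoc 4 C_U]
  generalize C_U * (d : ℝ) ^ ((1 : ℝ) + ω) = K at *
  have hpU : ∀ i, Continuous (pd U i) := fun i => by
    have := pd_contDiff (n := 2) (m := 1) (by exact_mod_cast hU) le_rfl i
    exact this.continuous
  have hpu : ∀ i, ContDiff ℝ 2 (pd u i) := fun i => by
    have := pd_contDiff (n := 3) (m := 2) (by exact_mod_cast hu) le_rfl i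
    exact_mod_cast this
  have hpuc : ∀ i, Continuous (pd u i) := fun i => (hpu i).continuous
  have hppu : ∀ i j, Continuous (pd (pd u i) j) := fun i j => by
    have := pd_contDiff (n := 2) (m := 1) (by exact_mod_cast hpu i) le_rfl j
    exact this.continuous
  have hρ : ∀ x, 0 ≤ Real.exp (-U x) / Z := fun x => by positivity
  have hG : ∫⁻ x, ENNReal.ofReal ((g x) ^ 2) ∂(gibbs d U Z) ≠ ⊤ := by
    have hgc0 := hg.continuous
    rw [gibbs_lintegral (h := fun x => g x ^ 2) hUc (by fun_prop) (fun x => sq_nonneg _)]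
    have hi : Integrable (fun x => g x ^ 2 * (Real.exp (-U x) / Z)) := by
      refine Continuous.integrable_of_hasCompactSupport (by fun_prop) ?_
      exact HasCompactSupport.mul_right (hgc.comp_left (g := fun t : ℝ => t ^ 2) (by simp))
    rw [← ofReal_integral_eq_lintegral_ofReal hi
      (ae_of_all _ fun x => mul_nonneg (sq_nonneg _) (hρ x))]
    exact ENNReal.ofReal_ne_top
  generalize ∫⁻ x, ENNReal.ofReal ((g x) ^ 2) ∂(gibbs d U Z) = G at *
  -- rewrite the gradient bound
  have hA : ∑ i, ∫⁻ x, ENNReal.ofReal (pd u i x ^ 2 * (Real.exp (-U x) / Z)) ≤ G := by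
    refine le_trans (le_of_eq ?_) hgradu2
    simp_rw [grad_norm]
    rw [gibbs_lintegral (h := fun x => ∑ i, pd u i x ^ 2) hUc (by fun_prop)
      (fun x => Finset.sum_nonneg fun i _ => sq_nonneg _),
      ← lintegral_finsetSum _ (fun i _ => (Continuous.measurable (by fun_prop)).ennreal_ofReal)]
    refine lintegral_congr fun x => ?_
    rw [← ENNReal.ofReal_sum_of_nonneg (fun i _ => mul_nonneg (sq_nonneg _) (hρ x)),
      Finset.sum_mul]
  have hB : ∑ i, ∫⁻ x, ENNReal.ofReal
      ((∑ j, (pd (pd u i) j x) ^ 2) * (Real.exp (-U x) / Z)) ≤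
      ENNReal.ofReal (2 * (2 + c_U)) * G := by
    refine le_trans (le_of_eq ?_) hhessu2
    have hH : ∀ x, hessFS d u x = ∑ i, ∑ j, (pd (pd u i) j x) ^ 2 := fun x => by
      rw [Finset.sum_comm]; rfl
    simp_rw [hH]
    rw [gibbs_lintegral (h := fun x => ∑ i, ∑ j, (pd (pd u i) j x) ^ 2) hUc (by fun_prop)
      (fun x => Finset.sum_nonneg fun i _ => Finset.sum_nonneg fun j _ => sq_nonneg _),
      ← lintegral_finsetSum _ (fun i _ => (Continuous.measurable (by fun_prop)).ennreal_ofReal)]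
    refine lintegral_congr fun x => ?_
    rw [← ENNReal.ofReal_sum_of_nonneg (fun i _ => mul_nonneg
      (Finset.sum_nonneg fun j _ => sq_nonneg _) (hρ x)), Finset.sum_mul]
  have hfull : ∀ i, _ := fun i => full_ineq (f := pd u i) hU ((hpu i).of_le (by norm_num))
    hZp hK hLap (ne_top_of_le_ne_top hG ((Finset.single_le_sum
      (f := fun i => ∫⁻ x, ENNReal.ofReal (pd u i x ^ 2 * (Real.exp (-U x) / Z)))
      (fun _ _ => zero_le) (Finset.mem_univ i)).trans hA))
  have hin : ∀ x, ⟪gradient U x, gradient u x⟫ ^ 2 ≤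
      (∑ j, (pd U j x) ^ 2) * ∑ i, (pd u i x) ^ 2 := fun x => by
    rw [← grad_norm, ← grad_norm, ← mul_pow]
    exact sq_le_sq' (by linarith [neg_abs_le ⟪gradient U x, gradient u x⟫,
      abs_real_inner_le_norm (gradient U x) (gradient u x)]) (real_inner_le_norm _ _)
  calc _ ≤ ∫⁻ x, ENNReal.ofReal ((∑ j, (pd U j x) ^ 2) * ∑ i, (pd u i x) ^ 2) ∂(gibbs d U Z) :=
        lintegral_mono fun x => ENNReal.ofReal_le_ofReal (hin x)
    _ = ∑ i, ∫⁻ x, ENNReal.ofReal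
        ((∑ j, (pd U j x) ^ 2) * pd u i x ^ 2 * (Real.exp (-U x) / Z)) := by
      rw [gibbs_lintegral (h := fun x => (∑ j, (pd U j x) ^ 2) * ∑ i, (pd u i x) ^ 2) hUc
        (by fun_prop) (fun x => by positivity),
        ← lintegral_finsetSum _
          (fun i _ => (Continuous.measurable (by fun_prop)).ennreal_ofReal)]
      refine lintegral_congr fun x => ?_
      have := hρ x
      rw [← ENNReal.ofReal_sum_of_nonneg (fun i _ => by positivity), ← Finset.sum_mul,
        ← Finset.mul_sum]
    _ ≤ _ := Finset.sum_le_sum fun i _ => hfull i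
    _ = _ := by rw [Finset.sum_add_distrib, ← Finset.mul_sum, ← Finset.mul_sum]
    _ ≤ ENNReal.ofReal (4 * K) * G +
        ENNReal.ofReal 16 * (ENNReal.ofReal (2 * (2 + c_U)) * G) := by gcongr
    _ = _ := by
      rw [← mul_assoc, ← ENNReal.ofReal_mul (by norm_num), ← add_mul,
        ← ENNReal.ofReal_add (by positivity) (by positivity)]
      congr 2
      ring
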